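/- Let G be a quasi-strongly connected directed graph on {1,…,N} with self-loops and radius r, and let ε > 0. Consider the LayerNorm dynamics X^{(t+1)}_{i,:} = (A^{(t)} X^{(t)} W^{(t)})_{i,:} / ‖(A^{(t)} X^{(t)} W^{(t)})_{i,:}‖₂, where each A^{(t)} is row-stochastic and ε-supported on G and each W^{(t)} ∈ ℝ^{d×d} is orthogonal. Assume X^{(0)} has unit-norm rows and φ^{(0)} := min_{i,j} ⟨X^{(0)}_{i,:}, X^{(0)}_{j,:}⟩ ≥ 0. Then for all t ≥ 0 the dynamics is well-defined, φ^{(t)} := min_{i,j} ⟨X^{(t)}_{i,:}, X^{(t)}_{j,:}⟩ ≥ 0, and the contraction inequality 1 − φ^{(t+r)} ≤ (1 − ε^{2r})(1 − φ^{(t)}) holds. -/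

import Mathlib

/-- Directed paths of length exactly `m` in the graph with edge relation `E`
(`E a b` means there is a directed edge from `a` to `b`). -/
def relPow {N : ℕ} (E : Fin N → Fin N → Prop) : ℕ → Fin N → Fin N → Prop
  | 0 => fun u v => u = v
  | m + 1 => fun u v => ∃ c, E u c ∧ relPow E m c v

open Matrix in
theorem conj_apply {m n : Type*} [Fintype n] (B : Matrix m n ℝ) (H : Matrix n n ℝ) (i j : m) :
    (B * H * Bᵀ) i j = ∑ k, ∑ l, B i k * B j l * H k l := by
  simp only [Matrix.mul_apply, Matrix.transpose_apply, Finset.sum_mul]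
  rw [Finset.sum_comm]
  exact Finset.sum_congr rfl fun k _ => Finset.sum_congr rfl fun l _ => by ring

open Matrix in
theorem conj_mono {m n : Type*} [Fintype n] {B : Matrix m n ℝ} (hB : ∀ i k, 0 ≤ B i k)
    {H K : Matrix n n ℝ} (h : ∀ k l, H k l ≤ K k l) (i j : m) :
    (B * H * Bᵀ) i j ≤ (B * K * Bᵀ) i j := by
  simp only [conj_apply]
  exact Finset.sum_le_sum fun k _ => Finset.sum_le_sum fun l _ =>
    mul_le_mul_of_nonneg_left (h k l) (mul_nonneg (hB i k) (hB j l))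

open Matrix in
theorem conj_const {m n : Type*} [Fintype n] {B : Matrix m n ℝ} (hB : ∀ i, ∑ k, B i k = 1)
    (a : ℝ) (i j : m) : (B * (Matrix.of fun _ _ => a : Matrix n n ℝ) * Bᵀ) i j = a := by
  simp [conj_apply, ← Finset.sum_mul, ← Finset.mul_sum, hB]

open Matrix in
theorem mul_mul_le_conj {m n : Type*} [Fintype n] {B : Matrix m n ℝ}
    (hB : ∀ i k, 0 ≤ B i k) {H : Matrix n n ℝ} (hH : ∀ k l, 0 ≤ H k l) (i j : m) (k l : n) :
    B i k * B j l * H k l ≤ (B * H * Bᵀ) i j := by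
  have h0 : ∀ k l, 0 ≤ B i k * B j l * H k l := fun k l =>
    mul_nonneg (mul_nonneg (hB i k) (hB j l)) (hH k l)
  rw [conj_apply]
  calc B i k * B j l * H k l ≤ ∑ l, B i k * B j l * H k l :=
        Finset.single_le_sum (f := fun l => B i k * B j l * H k l)
          (fun l _ => h0 k l) (Finset.mem_univ l)
    _ ≤ _ := Finset.single_le_sum (f := fun k => ∑ l, B i k * B j l * H k l)
          (fun k _ => Finset.sum_nonneg fun l _ => h0 k l) (Finset.mem_univ k)

/-- Averaging twice a kernel bounded below by `a` with value `1` at a common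
point of mass at least `δ` contracts the gap to `1` by the factor `1 - δ ^ 2`. -/
theorem one_sub_conj_le {m n : Type*} [Fintype n] {B : Matrix m n ℝ}
    (hB : ∀ i k, 0 ≤ B i k) (hB1 : ∀ i, ∑ k, B i k = 1) {H : Matrix n n ℝ} {a δ : ℝ}
    (ha : ∀ k l, a ≤ H k l) {c : n} (hc : H c c = 1) (hδ : 0 ≤ δ) (hBc : ∀ i, δ ≤ B i c)
    (i j : m) : 1 - (B * H * B.transpose) i j ≤ (1 - δ ^ 2) * (1 - a) := by
  have hle := mul_mul_le_conj hB (H := H - (Matrix.of fun _ _ => a : Matrix n n ℝ))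
    (fun k l => by simpa using ha k l) i j c c
  have hsub : (B * (H - (Matrix.of fun _ _ => a : Matrix n n ℝ)) * B.transpose) i j
      = (B * H * B.transpose) i j - a := by
    rw [Matrix.mul_sub, Matrix.sub_mul, Matrix.sub_apply, conj_const hB1]
  have h1a : 0 ≤ 1 - a := by linarith [ha c c]
  have hδ2 : δ * δ ≤ B i c * B j c := mul_le_mul (hBc i) (hBc j) hδ (hB i c)
  rw [hsub, Matrix.sub_apply, Matrix.of_apply, hc] at hle
  nlinarith [mul_le_mul_of_nonneg_right hδ2 h1a]

theorem gram_le_one {n κ : Type*} [Fintype κ] {X : Matrix n κ ℝ}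
    (hX : ∀ i, (X * X.transpose) i i = 1) (i j : n) : (X * X.transpose) i j ≤ 1 := by
  have hi := hX i
  have hj := hX j
  simp only [Matrix.mul_apply, Matrix.transpose_apply] at hi hj ⊢
  have h : ∑ k, (X i k * X j k + X i k * X j k) ≤ ∑ k, (X i k * X i k + X j k * X j k) :=
    Finset.sum_le_sum fun k _ => by nlinarith [sq_nonneg (X i k - X j k)]
  rw [Finset.sum_add_distrib, Finset.sum_add_distrib] at h
  linarith

theorem relPow_of_le {N : ℕ} {E : Fin N → Fin N → Prop} (hloop : ∀ i, E i i)
    {m n : ℕ} (hmn : m ≤ n) {u v : Fin N} (h : relPow E m u v) : relPow E n u v := by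
  induction n, hmn using Nat.le_induction with
  | base => exact h
  | succ n _ ih => exact ⟨u, hloop u, ih⟩

/-- Row normalization of a matrix. -/
noncomputable def rowNormalize {n κ : Type*} [Fintype κ] (M : Matrix n κ ℝ) : Matrix n κ ℝ :=
  Matrix.of fun i j => M i j / Real.sqrt (∑ k, M i k ^ 2)

theorem gram_rowNormalize {n κ : Type*} [Fintype κ] (M : Matrix n κ ℝ) (i j : n) :
    (rowNormalize M * (rowNormalize M).transpose) i j =
      (M * M.transpose) i j /
        (Real.sqrt ((M * M.transpose) i i) * Real.sqrt ((M * M.transpose) j j)) := by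
  simp only [rowNormalize, Matrix.mul_apply, Matrix.transpose_apply, Matrix.of_apply, pow_two,
    Finset.sum_div]
  exact Finset.sum_congr rfl fun k _ => div_mul_div_comm _ _ _ _

theorem gram_mul_mul_orthogonal {n κ : Type*} [Fintype n] [Fintype κ] [DecidableEq κ]
    (A : Matrix n n ℝ) (X : Matrix n κ ℝ) {W : Matrix κ κ ℝ} (hW : W * W.transpose = 1) :
    (A * X * W) * (A * X * W).transpose = A * (X * X.transpose) * A.transpose := by
  rw [Matrix.transpose_mul, Matrix.transpose_mul, Matrix.mul_assoc (A * X),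
    ← Matrix.mul_assoc W, hW, Matrix.one_mul]
  simp only [Matrix.mul_assoc]

theorem sq_diag_le_conj_diag {n : Type*} [Fintype n] {A H : Matrix n n ℝ}
    (hA : ∀ i j, 0 ≤ A i j) (hH : ∀ i j, 0 ≤ H i j) (hdiag : ∀ i, H i i = 1) (i : n) :
    A i i ^ 2 ≤ (A * H * A.transpose) i i := by
  have h := mul_mul_le_conj hA hH i i i i
  rw [hdiag] at h
  linarith

/-- Normalizing rows of norm at most one does not decrease their nonnegative inner products. -/
theorem gram_le_gram_rowNormalize {n κ : Type*} [Fintype κ] {M : Matrix n κ ℝ} {i j : n}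
    (hpos : ∀ i, 0 < (M * M.transpose) i i) (hle : ∀ i, (M * M.transpose) i i ≤ 1)
    (hnonneg : 0 ≤ (M * M.transpose) i j) :
    (M * M.transpose) i j ≤ (rowNormalize M * (rowNormalize M).transpose) i j := by
  rw [gram_rowNormalize]
  have hs : ∀ i, 0 < Real.sqrt ((M * M.transpose) i i) := fun i => Real.sqrt_pos.2 (hpos i)
  have hs1 : ∀ i, Real.sqrt ((M * M.transpose) i i) ≤ 1 := fun i => Real.sqrt_le_one.2 (hle i)
  exact le_div_self hnonneg (mul_pos (hs i) (hs j))
    (mul_le_one₀ (hs1 i) (hs j).le (hs1 j))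

theorem gram_rowNormalize_diag {n κ : Type*} [Fintype κ] {M : Matrix n κ ℝ} {i : n}
    (hpos : 0 < (M * M.transpose) i i) :
    (rowNormalize M * (rowNormalize M).transpose) i i = 1 := by
  rw [gram_rowNormalize, Real.mul_self_sqrt hpos.le, div_self hpos.ne']

/-- If `H (t + 1)` dominates the average of `H t` by row-stochastic matrices with entries at least
`ε` on the edges, then `H (t + m)` dominates an average of `H t` by a row-stochastic matrix with
entries at least `ε ^ m` on the paths of length `m`. -/
theorem exists_stochastic_conj_le {N : ℕ} {E : Fin N → Fin N → Prop} {ε : ℝ} (hε : 0 ≤ ε)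
    {A H : ℕ → Matrix (Fin N) (Fin N) ℝ} (hA : ∀ t i j, 0 ≤ A t i j)
    (hA1 : ∀ t i, ∑ j, A t i j = 1) (hAε : ∀ t i j, E j i → ε ≤ A t i j)
    (hH : ∀ t i j, (A t * H t * (A t).transpose) i j ≤ H (t + 1) i j) (m t : ℕ) :
    ∃ B : Matrix (Fin N) (Fin N) ℝ, (∀ i j, 0 ≤ B i j) ∧ (∀ i, ∑ j, B i j = 1) ∧
      (∀ i j, relPow E m j i → ε ^ m ≤ B i j) ∧
      ∀ i j, (B * H t * B.transpose) i j ≤ H (t + m) i j := by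
  induction m generalizing t with
  | zero =>
    refine ⟨1, fun i j => ?_, fun i => ?_, fun i j h => ?_, fun i j => ?_⟩
    · rw [Matrix.one_apply]; split_ifs <;> norm_num
    · simp [Matrix.one_apply]
    · obtain rfl : j = i := h
      simp
    · simp
  | succ m ih =>
    obtain ⟨B, hB, hB1, hBε, hBH⟩ := ih (t + 1)
    refine ⟨B * A t, fun i j => ?_, fun i => ?_, fun i j h => ?_, fun i j => ?_⟩
    · rw [Matrix.mul_apply]
      exact Finset.sum_nonneg fun k _ => mul_nonneg (hB i k) (hA t k j)
    · simp only [Matrix.mul_apply]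
      rw [Finset.sum_comm]
      simp [← Finset.mul_sum, hA1, hB1]
    · obtain ⟨c, hjc, hci⟩ := h
      calc ε ^ (m + 1) = ε ^ m * ε := pow_succ _ _
        _ ≤ B i c * A t c j := mul_le_mul (hBε i c hci) (hAε t c j hjc) hε (hB i c)
        _ ≤ (B * A t) i j := Finset.single_le_sum (f := fun k => B i k * A t k j)
            (fun k _ => mul_nonneg (hB i k) (hA t k j)) (Finset.mem_univ c)
    · calc (B * A t * H t * (B * A t).transpose) i j
          = (B * (A t * H t * (A t).transpose) * B.transpose) i j := by
            simp only [Matrix.transpose_mul, Matrix.mul_assoc]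
        _ ≤ (B * H (t + 1) * B.transpose) i j := conj_mono hB (hH t) i j
        _ ≤ H (t + (m + 1)) i j := by
            have h := hBH i j
            rwa [add_assoc, add_comm 1 m] at h

/-- For the row-normalized (LayerNorm) dynamics with row-stochastic
`ε`-supported attention matrices over a quasi-strongly connected graph with self-loops and
radius `r`, and orthogonal matrices `W^{(t)}`: if the minimal pairwise cosine similarity
`φ^{(0)}` of the unit-norm initial rows is nonnegative, then the dynamics is well-defined,
`φ^{(t)} ≥ 0` for all `t`, and `1 - φ^{(t+r)} ≤ (1 - ε^{2r})(1 - φ^{(t)})`. -/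
theorem cosine_similarity_contraction
    (N d : ℕ) (hN : 0 < N)
    (E : Fin N → Fin N → Prop)
    (hloop : ∀ i, E i i)
    (hqsc : ∃ v, ∀ u, ∃ m, relPow E m v u)
    (r : ℕ)
    (hradius : IsLeast {ρ : ℕ | ∃ v, ∀ u, ∃ m ≤ ρ, relPow E m v u} r)
    (ε : ℝ) (hε : 0 < ε)
    (A : ℕ → Matrix (Fin N) (Fin N) ℝ)
    (hA_nonneg : ∀ t i j, 0 ≤ A t i j)
    (hA_rowsum : ∀ t i, ∑ j, A t i j = 1)
    (hA_supp : ∀ t i j, (E j i → ε ≤ A t i j) ∧ (¬ E j i → A t i j = 0))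
    (W : ℕ → Matrix (Fin d) (Fin d) ℝ)
    (hW : ∀ t, W t * (W t).transpose = 1)
    (X : ℕ → Matrix (Fin N) (Fin d) ℝ)
    (hunit : ∀ i, ∑ k, (X 0 i k) ^ 2 = 1)
    (hphi0 : 0 ≤ ⨅ p : Fin N × Fin N, ∑ k, X 0 p.1 k * X 0 p.2 k)
    (hX : ∀ t i j,
      X (t + 1) i j =
        (A t * X t * W t) i j / Real.sqrt (∑ k, ((A t * X t * W t) i k) ^ 2)) :
    ∀ t : ℕ,
      (∀ i, (fun k => (A t * X t * W t) i k) ≠ 0) ∧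
      0 ≤ ⨅ p : Fin N × Fin N, ∑ k, X t p.1 k * X t p.2 k ∧
      1 - (⨅ p : Fin N × Fin N, ∑ k, X (t + r) p.1 k * X (t + r) p.2 k) ≤
        (1 - ε ^ (2 * r)) *
          (1 - ⨅ p : Fin N × Fin N, ∑ k, X t p.1 k * X t p.2 k) := by
  have : Nonempty (Fin N) := ⟨⟨0, hN⟩⟩
  set H : ℕ → Matrix (Fin N) (Fin N) ℝ := fun t => X t * (X t).transpose
  have hphi : ∀ t, (⨅ p : Fin N × Fin N, ∑ k, X t p.1 k * X t p.2 k) =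
      ⨅ p : Fin N × Fin N, H t p.1 p.2 :=
    fun t => rfl
  simp only [hphi] at hphi0 ⊢
  have hinf : ∀ t i j, (⨅ p : Fin N × Fin N, H t p.1 p.2) ≤ H t i j := fun t i j =>
    ciInf_le (Set.finite_range fun p : Fin N × Fin N => H t p.1 p.2).bddBelow (i, j)
  have hXn : ∀ t, X (t + 1) = rowNormalize (A t * X t * W t) := fun t => Matrix.ext (hX t)
  have hM : ∀ t, (A t * X t * W t) * (A t * X t * W t).transpose = A t * H t * (A t).transpose :=
    fun t => gram_mul_mul_orthogonal _ _ (hW t)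
  have hpos : ∀ t, (∀ i j, 0 ≤ H t i j) → (∀ i, H t i i = 1) →
      ∀ i, 0 < ((A t * X t * W t) * (A t * X t * W t).transpose) i i := by
    intro t h0 h1 i
    rw [hM]
    exact (pow_pos (hε.trans_le ((hA_supp t i i).1 (hloop i))) 2).trans_le
      (sq_diag_le_conj_diag (hA_nonneg t) h0 h1 i)
  have hstep : ∀ t, (∀ i j, 0 ≤ H t i j) → (∀ i, H t i i = 1) →
      ∀ i j, 0 ≤ (A t * H t * (A t).transpose) i j ∧
        (A t * H t * (A t).transpose) i j ≤ H (t + 1) i j := by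
    intro t h0 h1 i j
    have hnn : 0 ≤ (A t * H t * (A t).transpose) i j := by
      rw [conj_apply]
      exact Finset.sum_nonneg fun k _ => Finset.sum_nonneg fun l _ =>
        mul_nonneg (mul_nonneg (hA_nonneg t i k) (hA_nonneg t j l)) (h0 k l)
    refine ⟨hnn, ?_⟩
    have hle : ∀ i, ((A t * X t * W t) * (A t * X t * W t).transpose) i i ≤ 1 := by
      intro i
      rw [hM, ← conj_const (hA_rowsum t) 1 i i]
      exact conj_mono (hA_nonneg t) (gram_le_one h1) i i
    have h := gram_le_gram_rowNormalize (i := i) (j := j) (hpos t h0 h1) hle (by rwa [hM])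
    rwa [← hXn, hM] at h
  have hinv : ∀ t, (∀ i j, 0 ≤ H t i j) ∧ ∀ i, H t i i = 1 := by
    intro t
    induction t with
    | zero =>
      refine ⟨fun i j => hphi0.trans (hinf 0 i j), fun i => ?_⟩
      rw [← hunit i]
      change (X 0 * (X 0).transpose) i i = _
      rw [Matrix.mul_apply]
      exact Finset.sum_congr rfl fun k _ => (pow_two (X 0 i k)).symm
    | succ t ih =>
      refine ⟨fun i j => (hstep t ih.1 ih.2 i j).1.trans (hstep t ih.1 ih.2 i j).2, fun i => ?_⟩
      have h := gram_rowNormalize_diag (hpos t ih.1 ih.2 i)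
      rwa [← hXn] at h
  intro t
  obtain ⟨h0, h1⟩ := hinv t
  refine ⟨fun i hi => ?_, le_ciInf fun p => h0 _ _, ?_⟩
  · refine (hpos t h0 h1 i).ne' ?_
    rw [Matrix.mul_apply]
    exact Finset.sum_eq_zero fun k _ => by rw [congrFun hi k, Pi.zero_apply, zero_mul]
  · obtain ⟨c, hc⟩ := hradius.1
    obtain ⟨B, hB, hB1, hBε, hBH⟩ := exists_stochastic_conj_le (H := H) hε.le hA_nonneg hA_rowsum
      (fun t i j => (hA_supp t i j).1)
      (fun t i j => (hstep t (hinv t).1 (hinv t).2 i j).2) r t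
    have hBc : ∀ i, ε ^ r ≤ B i c := by
      intro i
      obtain ⟨m, hm, hci⟩ := hc i
      exact hBε i c (relPow_of_le hloop hm hci)
    rw [sub_le_comm]
    refine le_ciInf fun p => ?_
    have h := one_sub_conj_le hB hB1 (hinf t) (h1 c) (pow_nonneg hε.le r) hBc p.1 p.2
    rw [← pow_mul, mul_comm r 2] at h
    linarith [hBH p.1 p.2]
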